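/- Let α : ℝ → ℝ be a function of bounded variation on ℝ with α(x) → a as x → +∞ and α(x) → b as x → −∞ for some a < 0 < b, and let (φ_t(x))_{t≥0} solve dφ_t(x) = α(φ_t(x))dt + dw(t), φ_0(x) = x. Then for every x ∈ ℝ, φ_t(x)/t → 0 as t → ∞ almost surely. -/

import Mathlib

open MeasureTheory ProbabilityTheory Filter Set

noncomputable section

/-- The σ-algebra generated by the process `w` up to time `t` (natural filtration). -/
def natSigma {Ω : Type*} [MeasurableSpace Ω] (w : ℝ → Ω → ℝ) (t : ℝ) : MeasurableSpace Ω :=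
  ⨆ s ∈ Set.Icc (0:ℝ) t, MeasurableSpace.comap (w s) inferInstance

/-- `w` is a one-dimensional Wiener process (Brownian motion) on `[0,∞)`:
continuous paths started at `0`, Gaussian increments `w t - w s ~ N(0, t-s)`,
and increments independent of the past. -/
structure IsWiener {Ω : Type*} [MeasureSpace Ω] (w : ℝ → Ω → ℝ) : Prop where
  isProb : IsProbabilityMeasure (ℙ : Measure Ω)
  meas : ∀ t : ℝ, Measurable (w t)
  init : ∀ᵐ ω ∂(ℙ : Measure Ω), w 0 ω = 0
  cont : ∀ᵐ ω ∂(ℙ : Measure Ω), Continuous fun t => w t ω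
  gauss : ∀ s t : ℝ, 0 ≤ s → s ≤ t →
    Measure.map (fun ω => w t ω - w s ω) ℙ = gaussianReal 0 ((t - s).toNNReal)
  indep : ∀ s t : ℝ, 0 ≤ s → s ≤ t →
    Indep (MeasurableSpace.comap (fun ω => w t ω - w s ω) inferInstance) (natSigma w s) ℙ

/-- `φ` is a strong solution of the SDE `dφ_t = α(φ_t) dt + dw(t)`, `φ_0 = x`:
it is adapted to the natural filtration of `w`, has continuous paths, and satisfies
the corresponding integral equation `φ_t = x + ∫_0^t α(φ_s) ds + w_t`. -/
structure IsStrongSolution {Ω : Type*} [MeasureSpace Ω] (α : ℝ → ℝ) (w : ℝ → Ω → ℝ)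
    (x : ℝ) (φ : ℝ → Ω → ℝ) : Prop where
  adapted : ∀ t : ℝ, 0 ≤ t → @Measurable Ω ℝ (natSigma w t) _ (φ t)
  init : ∀ ω, φ 0 ω = x
  cont : ∀ᵐ ω ∂(ℙ : Measure Ω), ContinuousOn (fun t => φ t ω) (Set.Ici 0)
  sde : ∀ᵐ ω ∂(ℙ : Measure Ω), ∀ t : ℝ, 0 ≤ t →
    φ t ω = x + (∫ s in (0:ℝ)..t, α (φ s ω)) + w t ω

/-- `L` is the local time of the path `X` at level `y` up to time `t`:
`L = lim_{ε↓0} (1/ε) ∫_0^t 1_{[y,y+ε)}(X_s) ds`. -/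
def IsLocalTime (X : ℝ → ℝ) (y t L : ℝ) : Prop :=
  Filter.Tendsto
    (fun ε : ℝ => (1/ε) * ∫ s in (0:ℝ)..t,
      Set.indicator (Set.Ico y (y + ε)) (fun _ => (1:ℝ)) (X s))
    (nhdsWithin 0 (Set.Ioi 0)) (nhds L)

/-- Condition (A): `α` has bounded variation on each compact subset of `ℝ`. -/
def CondA (α : ℝ → ℝ) : Prop := ∀ a b : ℝ, BoundedVariationOn α (Set.Icc a b)

/-- Condition (B): linear growth, `|α x|² ≤ C (1 + |x|²)` for some `C > 0`. -/
def CondB (α : ℝ → ℝ) : Prop := ∃ C > 0, ∀ x : ℝ, |α x| ^ 2 ≤ C * (1 + |x| ^ 2)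

/-- Condition (C): `α` has bounded variation on all of `ℝ`. -/
def CondC (α : ℝ → ℝ) : Prop := BoundedVariationOn α Set.univ

/-- Chaining along dyadic points: geometric control of the increments of `f` between consecutive
dyadic points of `[0, T]` controls `f` at all dyadic points. -/
lemma abs_dyadic_le {f : ℝ → ℝ} (hf0 : f 0 = 0) {T A q : ℝ} (hA : 0 ≤ A) (hq0 : 0 ≤ q)
    (hinc : ∀ k j : ℕ, j < 2 ^ k →
      |f (((j + 1 : ℕ) : ℝ) * T / 2 ^ k) - f ((j : ℝ) * T / 2 ^ k)| ≤ A * q ^ k)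
    (k : ℕ) : ∀ j : ℕ, j ≤ 2 ^ k →
      |f ((j : ℝ) * T / 2 ^ k)| ≤ A * ∑ i ∈ Finset.range (k + 1), q ^ i := by
  induction k with
  | zero =>
    intro j hj
    have h := hinc 0 0 (by norm_num)
    have hj' : j = 0 ∨ j = 1 := by simp at hj; omega
    rcases hj' with rfl | rfl
    · simpa [hf0] using hA
    · simpa [hf0] using h
  | succ k ih =>
    have heven : ∀ i : ℕ, ((2 * i : ℕ) : ℝ) * T / 2 ^ (k + 1) = (i : ℝ) * T / 2 ^ k := by
      intro i
      push_cast
      field_simp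
      ring
    intro j hj
    rw [Finset.sum_range_succ, mul_add]
    have hpos : 0 ≤ A * q ^ (k + 1) := by positivity
    rcases Nat.even_or_odd' j with ⟨i, rfl | rfl⟩
    · rw [heven]
      have := ih i (by rw [pow_succ] at hj; omega)
      linarith
    · have h1 := hinc (k + 1) (2 * i) (by omega)
      rw [heven] at h1
      have h2 := ih i (by rw [pow_succ] at hj; omega)
      have h3 := abs_sub_abs_le_abs_sub (f (((2 * i + 1 : ℕ) : ℝ) * T / 2 ^ (k + 1)))
        (f ((i : ℝ) * T / 2 ^ k))
      linarith

/-- Geometric control of the dyadic increments of a continuous function on `[0, T]` gives a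
uniform bound on `[0, T]`. -/
lemma abs_le_of_dyadic_increments {f : ℝ → ℝ} (hf : Continuous f) (hf0 : f 0 = 0) {T A q : ℝ}
    (hT : 0 < T) (hA : 0 ≤ A) (hq0 : 0 ≤ q) (hq1 : q < 1)
    (hinc : ∀ k j : ℕ, j < 2 ^ k →
      |f (((j + 1 : ℕ) : ℝ) * T / 2 ^ k) - f ((j : ℝ) * T / 2 ^ k)| ≤ A * q ^ k)
    {s : ℝ} (hs : s ∈ Icc 0 T) : |f s| ≤ A * (1 - q)⁻¹ := by
  have hlim : Tendsto (fun k : ℕ => (⌊s / T * 2 ^ k⌋₊ : ℝ) * T / 2 ^ k) atTop (nhds s) := by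
    have h1 := (tendsto_nat_floor_mul_div_atTop (div_nonneg hs.1 hT.le)).comp
      (tendsto_pow_atTop_atTop_of_one_lt (one_lt_two (α := ℝ)))
    have h2 := h1.mul_const T
    rw [div_mul_cancel₀ _ hT.ne'] at h2
    refine h2.congr fun k => ?_
    simp only [Function.comp_apply]
    ring
  refine le_of_tendsto ((hf.abs.tendsto s).comp hlim) (Eventually.of_forall fun k => ?_)
  have hle : ⌊s / T * 2 ^ k⌋₊ ≤ 2 ^ k := by
    apply Nat.floor_le_of_le
    push_cast
    exact mul_le_of_le_one_left (by positivity) ((div_le_one hT).2 hs.2)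
  refine (abs_dyadic_le hf0 hA hq0 hinc k _ hle).trans ?_
  gcongr
  rw [← tsum_geometric_of_lt_one hq0 hq1]
  exact (summable_geometric_of_lt_one hq0 hq1).sum_le_tsum _ fun i _ => by positivity

lemma lintegral_fourth_moment_gaussianReal_lt_top :
    ∫⁻ y, ENNReal.ofReal (y ^ 4) ∂(gaussianReal 0 1) < ⊤ := by
  have h := (memLp_id_gaussianReal (μ := 0) (v := 1) 4).integrable_norm_pow
    (p := 4) (by norm_num)
  have h' := h.lintegral_lt_top
  refine lt_of_le_of_lt (lintegral_mono fun y => ?_) h'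
  apply ENNReal.ofReal_le_ofReal
  simp [Even.pow_abs (by decide : Even 4)]

/-- Scaling of the fourth moment of Wiener increments. -/
lemma IsWiener.lintegral_increment {Ω : Type*} [MeasureSpace Ω] {w : ℝ → Ω → ℝ}
    (hw : IsWiener w) {s t : ℝ} (hs : 0 ≤ s) (hst : s ≤ t) :
    ∫⁻ ω, ENNReal.ofReal ((w t ω - w s ω) ^ 4) ∂(ℙ : Measure Ω) =
      ENNReal.ofReal ((t - s) ^ 2) * ∫⁻ y, ENNReal.ofReal (y ^ 4) ∂(gaussianReal 0 1) := by
  have hmeas : Measurable fun y : ℝ => ENNReal.ofReal (y ^ 4) := by fun_prop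
  have hts : 0 ≤ t - s := sub_nonneg.2 hst
  have hgauss : gaussianReal 0 ((t - s).toNNReal) =
      (gaussianReal 0 1).map (fun y => √(t - s) * y) := by
    rw [gaussianReal_map_const_mul, mul_zero]
    congr 1
    ext
    simp [Real.sq_sqrt hts, hts]
  have h1 := lintegral_map (μ := (ℙ : Measure Ω)) hmeas ((hw.meas t).sub (hw.meas s))
  simp only [Pi.sub_apply] at h1
  rw [← h1]
  have h2 : Measure.map (w t - w s) (ℙ : Measure Ω) = _ := hw.gauss s t hs hst
  rw [h2, hgauss, lintegral_map hmeas (by fun_prop), ← lintegral_const_mul _ hmeas]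
  refine lintegral_congr fun y => ?_
  rw [← ENNReal.ofReal_mul (by positivity), mul_pow,
    show √(t - s) ^ 4 = (√(t - s) ^ 2) ^ 2 by ring, Real.sq_sqrt hts]

/-- Almost surely, all dyadic increments of a Wiener process on the intervals `[0, 2 ^ n]` are
simultaneously controlled by a single random constant. -/
lemma IsWiener.ae_exists_increment_le {Ω : Type*} [MeasureSpace Ω] {w : ℝ → Ω → ℝ}
    (hw : IsWiener w) :
    ∀ᵐ ω ∂(ℙ : Measure Ω), ∃ C : ℝ, 0 ≤ C ∧ ∀ n k j : ℕ, j < 2 ^ k →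
      |w (((j + 1 : ℕ) : ℝ) * 2 ^ n / 2 ^ k) ω - w ((j : ℝ) * 2 ^ n / 2 ^ k) ω| ≤
        C * (3 / 2) ^ n * (9 / 10) ^ k := by
  set K := ∫⁻ y, ENNReal.ofReal (y ^ 4) ∂(gaussianReal 0 1) with hK
  have hKtop : K ≠ ⊤ := lintegral_fourth_moment_gaussianReal_lt_top.ne
  let X : ℕ → ℕ → ℕ → Ω → ℝ := fun n k j ω =>
    w (((j + 1 : ℕ) : ℝ) * 2 ^ n / 2 ^ k) ω - w ((j : ℝ) * 2 ^ n / 2 ^ k) ω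
  let c : ℕ → ℕ → ℝ := fun n k => ((3 / 2) ^ n * (9 / 10) ^ k) ^ 4
  have hc : ∀ n k, 0 < c n k := fun n k => by positivity
  let F : ℕ × ℕ → Ω → ENNReal := fun p ω =>
    ∑ j ∈ Finset.range (2 ^ p.2), ENNReal.ofReal ((c p.1 p.2)⁻¹) *
      ENNReal.ofReal (X p.1 p.2 j ω ^ 4)
  have hXm : ∀ n k j, Measurable (X n k j) := fun n k j => (hw.meas _).sub (hw.meas _)
  have hXF : ∀ n k j, Measurable fun ω => ENNReal.ofReal (X n k j ω ^ 4) :=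
    fun n k j => ((hXm n k j).pow_const 4).ennreal_ofReal
  have hFm : ∀ p, Measurable (F p) := fun p =>
    Finset.measurable_fun_sum _ fun j _ => (hXF _ _ _).const_mul _
  have hFint : ∀ p, ∫⁻ ω, F p ω ∂(ℙ : Measure Ω) =
      ENNReal.ofReal ((64 / 81) ^ p.1 * (5000 / 6561) ^ p.2) * K := by
    rintro ⟨n, k⟩
    simp only [F]
    rw [lintegral_finsetSum _ fun j _ => (hXF _ _ _).const_mul _]
    have hterm : ∀ j ∈ Finset.range (2 ^ k), ∫⁻ ω, ENNReal.ofReal ((c n k)⁻¹) *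
        ENNReal.ofReal (X n k j ω ^ 4) ∂(ℙ : Measure Ω) =
        ENNReal.ofReal ((c n k)⁻¹ * (2 ^ n / 2 ^ k) ^ 2) * K := by
      intro j _
      rw [lintegral_const_mul _ (hXF _ _ _), hw.lintegral_increment (by positivity) (by
        gcongr; simp), ENNReal.ofReal_mul (by positivity), mul_assoc]
      congr 3
      push_cast
      ring
    rw [Finset.sum_congr rfl hterm, Finset.sum_const, Finset.card_range, nsmul_eq_mul, ← mul_assoc,
      ← ENNReal.ofReal_natCast, ← ENNReal.ofReal_mul (by positivity)]
    congr 2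
    have e1 : (64 / 81 : ℝ) ^ n = (2 ^ n) ^ 2 / ((3 / 2) ^ n) ^ 4 := by
      rw [← pow_mul, ← pow_mul, mul_comm n 2, mul_comm n 4, pow_mul, pow_mul, ← div_pow]
      norm_num
    have e2 : (5000 / 6561 : ℝ) ^ k = 1 / (2 ^ k * ((9 / 10) ^ k) ^ 4) := by
      rw [← pow_mul, mul_comm k 4, pow_mul, ← mul_pow, ← one_div_pow]
      norm_num
    rw [e1, e2]
    simp only [c]
    push_cast
    field_simp
  have hsum : ∑' p, ∫⁻ ω, F p ω ∂(ℙ : Measure Ω) ≠ ⊤ := by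
    simp_rw [hFint]
    rw [ENNReal.tsum_mul_right]
    refine ENNReal.mul_ne_top (Summable.tsum_ofReal_ne_top ?_) hKtop
    exact (summable_geometric_of_lt_one (by norm_num) (by norm_num)).mul_of_nonneg
      (summable_geometric_of_lt_one (by norm_num) (by norm_num))
      (fun n => by positivity) (fun n => by positivity)
  rw [← lintegral_tsum fun p => (hFm p).aemeasurable] at hsum
  filter_upwards [ae_lt_top (Measurable.tsum hFm) hsum] with ω hω
  set S := ∑' p, F p ω with hS
  have hS1 : 1 ≤ 1 + S.toReal := by linarith [ENNReal.toReal_nonneg (a := S)]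
  refine ⟨1 + S.toReal, by linarith, fun n k j hj => ?_⟩
  have h1 : ENNReal.ofReal ((c n k)⁻¹ * X n k j ω ^ 4) ≤ S := by
    rw [ENNReal.ofReal_mul (inv_nonneg.2 (hc n k).le)]
    refine le_trans ?_ (ENNReal.le_tsum (n, k))
    exact Finset.single_le_sum
      (f := fun j => ENNReal.ofReal ((c n k)⁻¹) * ENNReal.ofReal (X n k j ω ^ 4))
      (fun _ _ => zero_le) (Finset.mem_range.2 hj)
  have h2 : (c n k)⁻¹ * X n k j ω ^ 4 ≤ S.toReal := (ENNReal.ofReal_le_iff_le_toReal hω.ne).1 h1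
  rw [inv_mul_le_iff₀ (hc n k)] at h2
  have h3 : |X n k j ω| ^ 4 ≤ ((1 + S.toReal) * (3 / 2) ^ n * (9 / 10) ^ k) ^ 4 := by
    rw [Even.pow_abs (by decide), mul_assoc, mul_pow]
    have h4 : S.toReal ≤ (1 + S.toReal) ^ 4 := by
      have := le_self_pow₀ hS1 (n := 4) (by norm_num)
      linarith
    calc X n k j ω ^ 4 ≤ c n k * S.toReal := h2
      _ ≤ c n k * (1 + S.toReal) ^ 4 := by gcongr
      _ = _ := mul_comm _ _
  exact le_of_pow_le_pow_left₀ (by norm_num) (by positivity) h3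

/-- The running maximum of a Wiener process grows sublinearly, almost surely. -/
lemma IsWiener.ae_abs_le_mul {Ω : Type*} [MeasureSpace Ω] {w : ℝ → Ω → ℝ} (hw : IsWiener w) :
    ∀ᵐ ω ∂(ℙ : Measure Ω), ∀ ε > 0, ∀ᶠ t : ℝ in atTop, ∀ s ∈ Icc 0 t, |w s ω| ≤ ε * t := by
  filter_upwards [hw.ae_exists_increment_le, hw.init, hw.cont] with ω ⟨C, hC, hinc⟩ h0 hcont
  intro ε hε
  have hbound : ∀ n : ℕ, ∀ s ∈ Icc (0 : ℝ) (2 ^ n), |w s ω| ≤ 10 * C * (3 / 2) ^ n := by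
    intro n s hs
    have h := abs_le_of_dyadic_increments (f := fun t => w t ω) hcont h0 (T := 2 ^ n)
      (A := C * (3 / 2) ^ n) (q := 9 / 10) (by positivity) (by positivity) (by norm_num)
      (by norm_num) (fun k j hj => hinc n k j hj) hs
    norm_num at h ⊢
    linarith
  have hlim : Tendsto (fun n : ℕ => 15 * C * (3 / 4 : ℝ) ^ n) atTop (nhds 0) := by
    simpa using (tendsto_pow_atTop_nhds_zero_of_lt_one (r := (3 / 4 : ℝ)) (by norm_num)
      (by norm_num)).const_mul (15 * C)
  obtain ⟨N, hN⟩ := eventually_atTop.1 (hlim.eventually (gt_mem_nhds hε))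
  filter_upwards [eventually_ge_atTop ((2 : ℝ) ^ N)] with t ht s hs
  obtain ⟨n, hn1, hn2⟩ := exists_nat_pow_near
    ((one_le_pow₀ (one_le_two (α := ℝ))).trans ht) (one_lt_two (α := ℝ))
  have hNn : N ≤ n := by
    have := (pow_lt_pow_iff_right₀ (one_lt_two (α := ℝ))).1 (ht.trans_lt hn2)
    omega
  calc |w s ω| ≤ 10 * C * (3 / 2) ^ (n + 1) := hbound (n + 1) s ⟨hs.1, hs.2.trans hn2.le⟩
    _ = 15 * C * (3 / 4) ^ n * 2 ^ n := by
      rw [mul_assoc _ ((3 / 4 : ℝ) ^ n), ← mul_pow, pow_succ]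
      norm_num
      ring
    _ ≤ ε * 2 ^ n := by gcongr; exact (hN n hNn).le
    _ ≤ ε * t := by gcongr

/-- A path driven by a drift that is nonpositive whenever the path exceeds `M` is bounded above
in terms of the bound on the noise. -/
lemma le_of_drift_nonpos_above {p g v : ℝ → ℝ} {x M B t : ℝ} (ht : 0 ≤ t)
    (hp : ContinuousOn p (Ici 0)) (hg : IntegrableOn g (Icc 0 t))
    (hsde : ∀ s, 0 ≤ s → p s = x + (∫ u in (0 : ℝ)..s, g u) + v s)
    (hdrift : ∀ s, 0 ≤ s → M < p s → g s ≤ 0) (hv : ∀ s ∈ Icc 0 t, |v s| ≤ B) :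
    p t ≤ |x| + |M| + 2 * B := by
  have hvt := abs_le.1 (hv t ⟨ht, le_rfl⟩)
  have hB : 0 ≤ B := (abs_nonneg _).trans (hv t ⟨ht, le_rfl⟩)
  have hneg : ∀ s ∈ Icc 0 t, (∀ u ∈ Ioc s t, M < p u) → ∫ u in s..t, g u ≤ 0 := by
    intro s hs h
    rw [intervalIntegral.integral_of_le hs.2]
    exact setIntegral_nonpos measurableSet_Ioc fun u hu =>
      hdrift u (hs.1.trans hu.1.le) (h u hu)
  have hMx := le_abs_self M
  have hMa := abs_nonneg M
  have hxx := le_abs_self x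
  have hxa := abs_nonneg x
  by_cases hne : (Icc 0 t ∩ p ⁻¹' Iic M).Nonempty
  · have hcl : IsClosed (Icc 0 t ∩ p ⁻¹' Iic M) :=
      (hp.mono Icc_subset_Ici_self).preimage_isClosed_of_isClosed isClosed_Icc isClosed_Iic
    have hcomp : IsCompact (Icc 0 t ∩ p ⁻¹' Iic M) :=
      isCompact_Icc.of_isClosed_subset hcl inter_subset_left
    obtain ⟨s, ⟨hs, hsM⟩, hmax⟩ := hcomp.exists_isGreatest hne
    have h1 := hneg s hs fun u hu => by
      by_contra! hle
      exact absurd (hmax ⟨⟨hs.1.trans hu.1.le, hu.2⟩, hle⟩) (not_le.2 hu.1)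
    have hi : ∀ r₁ ∈ Icc 0 t, ∀ r₂ ∈ Icc 0 t, IntervalIntegrable g volume r₁ r₂ :=
      fun r₁ h₁ r₂ h₂ => (hg.mono_set (ordConnected_Icc.uIcc_subset h₁ h₂)).intervalIntegrable
    have h2 := intervalIntegral.integral_add_adjacent_intervals
      (hi 0 ⟨le_rfl, ht⟩ s hs) (hi s hs t ⟨ht, le_rfl⟩)
    have h3 := hsde t ht
    have h4 := hsde s hs.1
    have h5 := abs_le.1 (hv s hs)
    have h6 : p s ≤ M := hsM
    linarith
  · have h1 := hneg 0 ⟨le_rfl, ht⟩ fun u hu => by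
      by_contra! hle
      exact hne ⟨u, ⟨hu.1.le, hu.2⟩, hle⟩
    have h3 := hsde t ht
    linarith

lemma CondC.measurable {α : ℝ → ℝ} (hC : CondC α) : Measurable α := by
  obtain ⟨p, q, hp, hq, rfl⟩ :=
    (BoundedVariationOn.locallyBoundedVariationOn hC).exists_monotoneOn_sub_monotoneOn
  exact (monotoneOn_univ.1 hp).measurable.sub (monotoneOn_univ.1 hq).measurable

lemma CondC.exists_abs_le {α : ℝ → ℝ} (hC : CondC α) : ∃ K, ∀ y, |α y| ≤ K := by
  refine ⟨|α 0| + (eVariationOn α univ).toReal, fun y => ?_⟩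
  have h := BoundedVariationOn.dist_le hC (mem_univ y) (mem_univ 0)
  rw [Real.dist_eq] at h
  linarith [abs_sub_abs_le_abs_sub (α y) (α 0)]

lemma CondC.integrableOn_comp {α : ℝ → ℝ} (hC : CondC α) {p : ℝ → ℝ}
    (hp : ContinuousOn p (Ici 0)) (t : ℝ) : IntegrableOn (fun s => α (p s)) (Icc 0 t) := by
  obtain ⟨K, hK⟩ := hC.exists_abs_le
  refine Integrable.of_bound ?_ K (Eventually.of_forall fun s => hK (p s))
  exact (hC.measurable.comp_aemeasurable
    ((hp.mono Icc_subset_Ici_self).aemeasurable measurableSet_Icc)).aestronglyMeasurable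

/-- Suppose `α` has bounded variation on `ℝ` and `α(x) → a < 0` as
`x → +∞`, `α(x) → b > 0` as `x → -∞`. Then for every `x`, almost surely
`φ_t(x)/t → 0` as `t → ∞`. -/
theorem sublinear_growth
    {Ω : Type*} [MeasureSpace Ω] (w : ℝ → Ω → ℝ) (hw : IsWiener w)
    (α : ℝ → ℝ) (hC : CondC α)
    (a b : ℝ) (ha : a < 0) (hb : 0 < b)
    (hlima : Filter.Tendsto α Filter.atTop (nhds a))
    (hlimb : Filter.Tendsto α Filter.atBot (nhds b))
    (x : ℝ) (φ : ℝ → Ω → ℝ) (hφ : IsStrongSolution α w x φ) :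
    ∀ᵐ ω ∂(ℙ : Measure Ω),
      Filter.Tendsto (fun t : ℝ => φ t ω / t) Filter.atTop (nhds 0) := by
  obtain ⟨M₁, hM₁⟩ := eventually_atTop.1 (hlima.eventually (gt_mem_nhds ha))
  obtain ⟨M₂, hM₂⟩ := eventually_atBot.1 (hlimb.eventually (lt_mem_nhds hb))
  filter_upwards [hw.ae_abs_le_mul, hφ.cont, hφ.sde] with ω hgrowth hcont hsde
  have hint := hC.integrableOn_comp hcont
  rw [Metric.tendsto_nhds]
  intro ε hε
  filter_upwards [hgrowth (ε / 4) (by positivity), eventually_gt_atTop 0,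
    eventually_gt_atTop (2 * (|x| + |M₁| + |M₂|) / ε)] with t hwt ht htlarge
  rw [div_lt_iff₀ hε] at htlarge
  have hupper := le_of_drift_nonpos_above (v := fun s => w s ω) ht.le hcont (hint t) hsde
    (fun s _ hs => (hM₁ _ hs.le).le) hwt
  have hlower := le_of_drift_nonpos_above (p := fun s => -φ s ω) (g := fun s => -α (φ s ω))
    (v := fun s => -w s ω) (x := -x) (M := -M₂) ht.le hcont.neg (hint t).neg
    (fun s hs => by rw [hsde s hs, intervalIntegral.integral_neg]; ring)
    (fun s _ hs => neg_nonpos.2 (hM₂ _ (neg_lt_neg_iff.1 hs).le).le)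
    (fun s hs => by simpa using hwt s hs)
  rw [abs_neg, abs_neg] at hlower
  have h₁ := abs_nonneg M₁
  have h₂ := abs_nonneg M₂
  rw [Real.dist_eq, sub_zero, abs_div, abs_of_pos ht, div_lt_iff₀ ht, abs_lt]
  constructor <;> linarith

end
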